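/- arXiv:2302.03000 — 4 statements merged into one kernel-verified Lean document; each statement's English description precedes it below -/
import Mathlib

section
/- (Bunt, 1934) Every Chebyshev subset of the Euclidean plane ℝ² is convex. -/
open Metric

section ProperInnerProductSpace

open Filter Topology

variable {E : Type*} [NormedAddCommGroup E]

/-- A set that contains a nearest point to every point of the space is closed. -/
theorem isClosed_of_exists_norm_sub_eq_infDist {J : Set E}
    (h : ∀ x : E, ∃ y ∈ J, ‖x - y‖ = infDist x J) : IsClosed J := by
  refine isClosed_of_closure_subset fun x hx => ?_
  obtain ⟨y, hy, hxy⟩ := h x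
  rw [(mem_closure_iff_infDist_zero ⟨y, hy⟩).1 hx, norm_eq_zero, sub_eq_zero] at hxy
  exact hxy ▸ hy

/-- The metric projection onto a Chebyshev subset of a proper space is continuous. -/
theorem continuous_metricProjection [ProperSpace E] {J : Set E} {P : E → E}
    (hJ : IsClosed J) (hP : ∀ x, P x ∈ J) (hdist : ∀ x, ‖x - P x‖ = infDist x J)
    (huniq : ∀ x y, y ∈ J → ‖x - y‖ = infDist x J → y = P x) : Continuous P := by
  refine continuous_iff_continuousAt.2 fun x => ?_
  have hbound : ∀ᶠ z in 𝓝 x, P z ∈ closedBall x (infDist x J + 3) := by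
    filter_upwards [ball_mem_nhds x one_pos] with z hz
    rw [mem_ball] at hz
    have h₁ : infDist z J ≤ infDist x J + dist z x := infDist_le_infDist_add_dist
    have h₂ : dist (P z) x ≤ dist (P z) z + dist z x := dist_triangle _ _ _
    rw [dist_comm (P z) z, dist_eq_norm z (P z), hdist] at h₂
    rw [mem_closedBall]
    linarith
  refine (isCompact_closedBall x _).tendsto_nhds_of_unique_mapClusterPt hbound
    fun q _ hq => ?_
  obtain ⟨U, hU, hPq⟩ := mapClusterPt_iff_ultrafilter.1 hq
  have hid : Tendsto (fun z : E => z) U (𝓝 x) := hU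
  have hlim : Tendsto (fun z => ‖z - P z‖) U (𝓝 ‖x - q‖) := (hid.sub hPq).norm
  simp only [hdist] at hlim
  exact huniq x q (hJ.mem_of_tendsto hPq (Eventually.of_forall hP))
    (tendsto_nhds_unique hlim (((continuous_infDist_pt J).tendsto x).comp hid))

/-- The Asplund function of `J`, whose gradient is the metric projection onto `J`. -/
noncomputable def asplundFunction (J : Set E) (x : E) : ℝ := (‖x‖ ^ 2 - infDist x J ^ 2) / 2

theorem continuous_asplundFunction (J : Set E) : Continuous (asplundFunction J) := by
  have := continuous_infDist_pt J
  unfold asplundFunction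
  fun_prop

variable [InnerProductSpace ℝ E]

theorem inner_sub_le_asplundFunction {J : Set E} {z : E} (hz : z ∈ J) (x : E) :
    inner ℝ x z - ‖z‖ ^ 2 / 2 ≤ asplundFunction J x := by
  have h₁ : infDist x J ≤ ‖x - z‖ := dist_eq_norm x z ▸ infDist_le_dist_of_mem hz
  have h₂ := pow_le_pow_left₀ infDist_nonneg h₁ 2
  rw [norm_sub_sq_real] at h₂
  unfold asplundFunction
  linarith

theorem asplundFunction_eq {J : Set E} {x p : E} (h : ‖x - p‖ = infDist x J) :
    asplundFunction J x = inner ℝ x p - ‖p‖ ^ 2 / 2 := by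
  rw [asplundFunction, ← h, norm_sub_sq_real]
  ring

/-- First order condition for a minimizer of the regularized Asplund function. -/
theorem metricProjection_eq_of_forall_le {J : Set E} {P : E → E} (hcont : Continuous P)
    (hP : ∀ x, P x ∈ J) (hdist : ∀ x, ‖x - P x‖ = infDist x J) {ε : ℝ} {y x₀ : E}
    (hmin : ∀ x, asplundFunction J x₀ - inner ℝ x₀ y + ε / 2 * ‖x₀‖ ^ 2 ≤
      asplundFunction J x - inner ℝ x y + ε / 2 * ‖x‖ ^ 2) :
    P x₀ - y + ε • x₀ = 0 := by
  set v := P x₀ - y + ε • x₀ with hv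
  have hle : ∀ t : ℝ, 0 < t →
      inner ℝ v (P (x₀ - t • v) - y + ε • x₀) ≤ ε / 2 * t * ‖v‖ ^ 2 := by
    intro t ht
    have h₁ := hmin (x₀ - t • v)
    have h₂ := inner_sub_le_asplundFunction (hP (x₀ - t • v)) x₀
    rw [asplundFunction_eq (hdist (x₀ - t • v)), norm_sub_sq_real] at h₁
    simp only [inner_sub_left, inner_smul_left, inner_smul_right, norm_smul, mul_pow,
      Real.norm_eq_abs, sq_abs, RCLike.conj_to_real] at h₁
    rw [inner_add_right, inner_sub_right, inner_smul_right]
    rw [real_inner_comm v x₀] at h₁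
    refine le_of_mul_le_mul_left ?_ ht
    linarith
  have hline : Tendsto (fun t : ℝ => inner ℝ v (P (x₀ - t • v) - y + ε • x₀))
      (𝓝[>] 0) (𝓝 (inner ℝ v v)) := by
    have : Continuous fun t : ℝ => inner ℝ v (P (x₀ - t • v) - y + ε • x₀) := by fun_prop
    simpa [← hv] using (this.tendsto 0).mono_left nhdsWithin_le_nhds
  have hzero : Tendsto (fun t : ℝ => ε / 2 * t * ‖v‖ ^ 2) (𝓝[>] 0) (𝓝 0) := by
    have : Continuous fun t : ℝ => ε / 2 * t * ‖v‖ ^ 2 := by fun_prop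
    simpa using (this.tendsto 0).mono_left nhdsWithin_le_nhds
  have hvv := le_of_tendsto_of_tendsto hline hzero
    (eventually_nhdsWithin_of_forall fun t ht => hle t ht)
  rw [real_inner_self_eq_norm_sq] at hvv
  exact norm_eq_zero.1 (sq_nonpos_iff _ |>.1 hvv)

/-- Every Chebyshev subset of a proper real inner product space is convex. -/
theorem convex_of_existsUnique_norm_sub_eq_infDist [ProperSpace E] {J : Set E}
    (hcheb : ∀ x : E, ∃! y, y ∈ J ∧ ‖x - y‖ = infDist x J) : Convex ℝ J := by
  have hJ : IsClosed J := isClosed_of_exists_norm_sub_eq_infDist fun x => (hcheb x).exists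
  choose P hmem huniq using hcheb
  have hP x := (hmem x).1
  have hdist x := (hmem x).2
  have hcont : Continuous P :=
    continuous_metricProjection hJ hP hdist fun x y hy hxy => huniq x y ⟨hy, hxy⟩
  intro a ha b hb s t hs ht hst
  set y := s • a + t • b with hy
  set m := -(s * ‖a‖ ^ 2 + t * ‖b‖ ^ 2) / 2 with hm
  have hlower : ∀ x, m ≤ asplundFunction J x - inner ℝ x y := by
    intro x
    have h₁ := mul_le_mul_of_nonneg_left (inner_sub_le_asplundFunction ha x) hs
    have h₂ := mul_le_mul_of_nonneg_left (inner_sub_le_asplundFunction hb x) ht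
    have h₃ : s * asplundFunction J x + t * asplundFunction J x = asplundFunction J x := by
      rw [← add_mul, hst, one_mul]
    rw [hy, inner_add_right, inner_smul_right, inner_smul_right]
    linarith
  set C := 2 * (asplundFunction J 0 - m) with hC
  have hC0 : 0 ≤ C := by
    have := hlower 0
    rw [inner_zero_left] at this
    linarith
  rw [← hJ.closure_eq, Metric.mem_closure_iff]
  intro δ hδ
  have hCpos : 0 < C + 1 := by linarith
  set ε := δ ^ 2 / (C + 1) with hε
  have hεpos : 0 < ε := by positivity
  have hcoercive : Tendsto (fun x => asplundFunction J x - inner ℝ x y + ε / 2 * ‖x‖ ^ 2)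
      (cocompact E) atTop := by
    refine tendsto_atTop_add_left_of_le _ m hlower ?_
    exact ((tendsto_pow_atTop two_ne_zero).comp tendsto_norm_cocompact_atTop).const_mul_atTop
      (half_pos hεpos)
  have hGcont : Continuous fun x => asplundFunction J x - inner ℝ x y + ε / 2 * ‖x‖ ^ 2 := by
    have := continuous_asplundFunction J
    fun_prop
  obtain ⟨x₀, hx₀⟩ := hGcont.exists_forall_le hcoercive
  have hcrit := metricProjection_eq_of_forall_le hcont hP hdist hx₀
  have hnorm : ε * ‖x₀‖ ^ 2 ≤ C := by
    have h₁ := hx₀ 0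
    have h₂ := hlower x₀
    simp only [inner_zero_left, norm_zero] at h₁
    linarith
  refine ⟨P x₀, hP x₀, ?_⟩
  have hsub : y - P x₀ = ε • x₀ := by
    rw [eq_comm, ← sub_eq_zero, ← hcrit]
    abel
  rw [dist_eq_norm, hsub]
  refine lt_of_pow_lt_pow_left₀ 2 hδ.le ?_
  rw [norm_smul, mul_pow, Real.norm_eq_abs, sq_abs]
  calc ε ^ 2 * ‖x₀‖ ^ 2 = ε * (ε * ‖x₀‖ ^ 2) := by ring
    _ ≤ ε * C := by gcongr
    _ < ε * (C + 1) := by gcongr; linarith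
    _ = δ ^ 2 := div_mul_cancel₀ _ hCpos.ne'

end ProperInnerProductSpace

/-- (Bunt, 1934) Every Chebyshev subset of the Euclidean plane is convex. -/
theorem chebyshev_convex_euclidean_plane
    (J : Set (EuclideanSpace ℝ (Fin 2)))
    (hcheb : ∀ x : EuclideanSpace ℝ (Fin 2),
      ∃! y, y ∈ J ∧ ‖x - y‖ = infDist x J) :
    Convex ℝ J :=
  convex_of_existsUnique_norm_sub_eq_infDist hcheb
end

section
/- (Kritikos, 1938) For every natural number n, every Chebyshev subset of the n-dimensional Euclidean space ℝⁿ is convex. -/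
open Metric

section Chebyshev

theorem isClosed_of_forall_existsUnique_nearest {E : Type*} [NormedAddCommGroup E] {J : Set E}
    (hJ : ∀ x : E, ∃! y, y ∈ J ∧ ‖x - y‖ = infDist x J) : IsClosed J := by
  refine isClosed_of_closure_subset fun x hx => ?_
  obtain ⟨y, ⟨hyJ, hy⟩, -⟩ := hJ x
  rw [(mem_closure_iff_infDist_zero ⟨y, hyJ⟩).1 hx, norm_eq_zero, sub_eq_zero] at hy
  rwa [hy]

variable {E : Type*} [NormedAddCommGroup E] [InnerProductSpace ℝ E] [ProperSpace E]

/-- Near a point off a Chebyshev set there are points at which the distance to the set has grown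
at any prescribed rate `μ < 1`. -/
theorem exists_infDist_add_mul_norm_le {J : Set E}
    (hJ : ∀ x : E, ∃! y, y ∈ J ∧ ‖x - y‖ = infDist x J) {z : E} (hz : 0 < infDist z J)
    {μ : ℝ} (hμ₀ : 0 ≤ μ) (hμ : μ < 1) {ε : ℝ} (hε : 0 < ε) :
    ∃ v : E, 0 < ‖v‖ ∧ ‖v‖ < ε ∧ infDist z J + μ * ‖v‖ ≤ infDist (z + v) J := by
  have hclosed := isClosed_of_forall_existsUnique_nearest hJ
  obtain ⟨p, ⟨hpJ, hp⟩, hpu⟩ := hJ z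
  set d := infDist z J with hd
  set u : E := d⁻¹ • (z - p) with hu
  have hu1 : ‖u‖ = 1 := by
    rw [hu, norm_smul, hp, norm_inv, Real.norm_of_nonneg hz.le, inv_mul_cancel₀ hz.ne']
  have hup : inner ℝ u (z - p) = d := by
    rw [hu, real_inner_smul_left, real_inner_self_eq_norm_sq, hp]
    field_simp
  -- By compactness, the points of `J` violating the angle condition are uniformly far from `z`.
  obtain ⟨δ, hδ, hfar⟩ : ∃ δ > 0, ∀ y ∈ J, ‖z - y‖ ≤ d + δ → μ * d < inner ℝ u (z - y) := by
    let K : Set E := (J ∩ {y | inner ℝ u (z - y) ≤ μ * d}) ∩ closedBall z (d + 1)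
    have hK : IsCompact K := (isCompact_closedBall z (d + 1)).inter_left
      (hclosed.inter (isClosed_le (by fun_prop) (by fun_prop)))
    rcases K.eq_empty_or_nonempty with hKe | hKne
    · refine ⟨1, one_pos, fun y hy hzy => ?_⟩
      by_contra! h
      have : y ∈ K := ⟨⟨hy, h⟩, by rwa [mem_closedBall, dist_comm, dist_eq_norm]⟩
      simp [hKe] at this
    · obtain ⟨k, hk, hkmin⟩ := hK.exists_isMinOn (f := fun y => ‖z - y‖) hKne
        (by fun_prop)
      have hdk : d < ‖z - k‖ := by
        refine lt_of_le_of_ne ?_ fun h => ?_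
        · rw [← dist_eq_norm]; exact infDist_le_dist_of_mem hk.1.1
        · have hkp := hpu k ⟨hk.1.1, h.symm⟩
          have := hk.1.2
          rw [Set.mem_ofPred_eq, hkp, hup] at this
          nlinarith
      refine ⟨min 1 ((‖z - k‖ - d) / 2), lt_min one_pos (by linarith), fun y hy hzy => ?_⟩
      have h1 := min_le_left 1 ((‖z - k‖ - d) / 2)
      have h2 := min_le_right 1 ((‖z - k‖ - d) / 2)
      by_contra! h
      have hyK : y ∈ K :=
        ⟨⟨hy, h⟩, by rw [mem_closedBall, dist_comm, dist_eq_norm]; linarith⟩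
      have := isMinOn_iff.1 hkmin y hyK
      linarith
  obtain ⟨s, hs, hsε⟩ := exists_between (lt_min hε (half_pos hδ))
  have hs1 := hsε.trans_le (min_le_left _ _)
  have hs2 := hsε.trans_le (min_le_right _ _)
  have hnorm : ‖s • u‖ = s := by rw [norm_smul, hu1, mul_one, Real.norm_of_nonneg hs.le]
  refine ⟨s • u, by rwa [hnorm], by rwa [hnorm], ?_⟩
  rw [hnorm]
  obtain ⟨q, ⟨hqJ, hq⟩, -⟩ := hJ (z + s • u)
  have hlip : infDist (z + s • u) J ≤ d + s := by
    have := infDist_le_infDist_add_dist (s := J) (x := z + s • u) (y := z)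
    rwa [dist_eq_norm, add_sub_cancel_left, hnorm] at this
  have hzq : ‖z - q‖ ≤ d + δ := by
    have : ‖z - q‖ ≤ ‖z + s • u - q‖ + ‖s • u‖ := by
      have := norm_sub_le (z + s • u - q) (s • u)
      rwa [show z + s • u - q - s • u = z - q by abel] at this
    rw [hq, hnorm] at this
    linarith
  have hang := hfar q hqJ hzq
  have hdq : d ≤ ‖z - q‖ := by rw [← dist_eq_norm]; exact infDist_le_dist_of_mem hqJ
  rw [← hq]
  refine le_of_sq_le_sq ?_ (norm_nonneg _)
  rw [show z + s • u - q = (z - q) + s • u by abel, norm_add_sq_real, hnorm,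
    real_inner_smul_right, real_inner_comm]
  nlinarith [mul_lt_mul_of_pos_left hang hs, mul_nonneg (sq_nonneg s) (sub_nonneg.2 hμ.le),
    mul_nonneg (mul_nonneg (sq_nonneg s) hμ₀) (sub_nonneg.2 hμ.le),
    (sq_le_sq₀ hz.le (norm_nonneg _)).2 hdq]

/-- Every sphere around a point off a Chebyshev set contains points at which the distance to the
set has grown by almost the radius. -/
theorem exists_infDist_add_mul_le {J : Set E}
    (hJ : ∀ x : E, ∃! y, y ∈ J ∧ ‖x - y‖ = infDist x J) {x : E} (hx : 0 < infDist x J)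
    {l : ℝ} (hl₀ : 0 ≤ l) (hl : l < 1) {r : ℝ} (hr : 0 ≤ r) :
    ∃ z : E, ‖z - x‖ = r ∧ infDist x J + l * r ≤ infDist z J := by
  obtain ⟨z, hz, hmax⟩ := (isCompact_closedBall x r).exists_isMaxOn
    (f := fun z => infDist z J - l * ‖z - x‖) ⟨x, mem_closedBall_self hr⟩
    ((continuous_infDist_pt J).sub (by fun_prop)).continuousOn
  rw [isMaxOn_iff] at hmax
  have hzx := hmax x (mem_closedBall_self hr)
  rw [mem_closedBall, dist_eq_norm] at hz
  simp only [sub_self, norm_zero, mul_zero, sub_zero] at hzx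
  have hzr : ‖z - x‖ = r := by
    by_contra hne
    have hlt := lt_of_le_of_ne hz hne
    obtain ⟨μ, hlμ, hμ⟩ := exists_between hl
    obtain ⟨v, hv₀, hv, hvd⟩ := exists_infDist_add_mul_norm_le hJ (z := z)
      (by nlinarith [mul_nonneg hl₀ (norm_nonneg (z - x))]) (hl₀.trans hlμ.le) hμ
      (sub_pos.2 hlt)
    have hadd : ‖z + v - x‖ ≤ ‖z - x‖ + ‖v‖ := by
      rw [add_sub_right_comm]; exact norm_add_le _ _
    have := hmax (z + v) (by rw [mem_closedBall, dist_eq_norm]; linarith)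
    nlinarith [mul_le_mul_of_nonneg_left hadd hl₀, mul_lt_mul_of_pos_right hlμ hv₀]
  exact ⟨z, hzr, by rw [hzr] at hzx; linarith⟩

theorem convex_of_forall_existsUnique_nearest {J : Set E}
    (hJ : ∀ x : E, ∃! y, y ∈ J ∧ ‖x - y‖ = infDist x J) : Convex ℝ J := by
  intro a ha b hb s t hs ht hst
  by_contra hx
  set x := s • a + t • b with hxdef
  have hd := ((isClosed_of_forall_existsUnique_nearest hJ).notMem_iff_infDist_pos ⟨a, ha⟩).1 hx
  set d := infDist x J with hddef
  set C := s * ‖x - a‖ ^ 2 + t * ‖x - b‖ ^ 2 with hC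
  have hC₀ : 0 ≤ C := by positivity
  set r := C / d + d with hr
  have hr₀ : 0 < r := by positivity
  have hdr : d * r = C + d ^ 2 := by rw [hr]; field_simp
  have hdr' : d ≤ r := le_add_of_nonneg_left (by positivity)
  obtain ⟨z, hzx, hz⟩ := exists_infDist_add_mul_le hJ hd (l := 1 - d / (2 * r))
    (by rw [sub_nonneg, div_le_one (by positivity)]; linarith)
    (sub_lt_self _ (by positivity)) hr₀.le
  have hz' : r + d / 2 ≤ infDist z J := by
    convert hz using 1
    field_simp
    ring
  have hfar : ∀ y ∈ J, (r + d / 2) ^ 2 ≤ ‖z - y‖ ^ 2 := fun y hy => by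
    have := hz'.trans (infDist_le_dist_of_mem hy)
    rw [dist_eq_norm] at this
    exact pow_le_pow_left₀ (by positivity) this 2
  have hexp : ∀ y, ‖z - y‖ ^ 2 = r ^ 2 + 2 * inner ℝ (z - x) (x - y) + ‖x - y‖ ^ 2 := fun y => by
    rw [← sub_add_sub_cancel z x y, norm_add_sq_real, hzx]
  have hbary : s * inner ℝ (z - x) (x - a) + t * inner ℝ (z - x) (x - b) = 0 := by
    rw [← real_inner_smul_right, ← real_inner_smul_right, ← inner_add_right,
      show s • (x - a) + t • (x - b) = (s + t) • x - x by rw [hxdef]; module, hst, one_smul,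
      sub_self, inner_zero_right]
  have h₁ := mul_le_mul_of_nonneg_left (hfar a ha) hs
  have h₂ := mul_le_mul_of_nonneg_left (hfar b hb) ht
  rw [hexp] at h₁ h₂
  have hsum : (s + t) * (r + d / 2) ^ 2 ≤ (s + t) * r ^ 2 + C := by
    rw [hC]; linarith
  rw [hst] at hsum
  nlinarith

end Chebyshev

/-- (Kritikos, 1938) Every Chebyshev subset of `n`-dimensional Euclidean space
is convex. -/
theorem chebyshev_convex_euclidean
    (n : ℕ) (J : Set (EuclideanSpace ℝ (Fin n)))
    (hcheb : ∀ x : EuclideanSpace ℝ (Fin n),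
      ∃! y, y ∈ J ∧ ‖x - y‖ = infDist x J) :
    Convex ℝ J :=
  convex_of_forall_existsUnique_nearest hcheb
end

section
/- (Efimov–Stechkin, 1961) Let H be a real Hilbert space and let K be a Chebyshev subset of H that is approximately compact. Then K is convex. -/
open Metric Filter

/-- A continuous function on a complete space that is bounded below and uniformly midpoint convex
attains its minimum. -/
theorem exists_forall_le_of_strongly_midpoint_convex
    {H : Type*} [NormedAddCommGroup H] [NormedSpace ℝ H] [CompleteSpace H]
    {F : H → ℝ} (hF : Continuous F) (hbdd : BddBelow (Set.range F)) {c : ℝ} (hc : 0 < c)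
    (hmid : ∀ a b, F ((1 / 2 : ℝ) • (a + b)) ≤ (F a + F b) / 2 - c * ‖a - b‖ ^ 2) :
    ∃ x, ∀ y, F x ≤ F y := by
  have hle : ∀ y, iInf F ≤ F y := fun y => ciInf_le hbdd y
  have hex : ∀ n : ℕ, ∃ u, F u < iInf F + 1 / ((n : ℝ) + 1) := fun n =>
    exists_lt_of_ciInf_lt (lt_add_of_pos_right _ Nat.one_div_pos_of_nat)
  choose u hu using hex
  have hcauchy : CauchySeq u := by
    refine Metric.cauchySeq_iff'.2 fun δ hδ => ?_
    obtain ⟨N, hN⟩ := exists_nat_one_div_lt (show 0 < c * δ ^ 2 by positivity)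
    refine ⟨N, fun n hn => ?_⟩
    have hnN : 1 / ((n : ℝ) + 1) ≤ 1 / ((N : ℝ) + 1) := Nat.one_div_le_one_div hn
    have hsq : c * ‖u n - u N‖ ^ 2 < c * δ ^ 2 := by
      linarith [hmid (u n) (u N), hle ((1 / 2 : ℝ) • (u n + u N)), hu n, hu N]
    rw [dist_eq_norm]
    exact lt_of_pow_lt_pow_left₀ 2 hδ.le (lt_of_mul_lt_mul_left hsq hc.le)
  obtain ⟨x, hx⟩ := cauchySeq_tendsto_of_complete hcauchy
  refine ⟨x, fun y => le_trans ?_ (hle y)⟩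
  refine le_of_tendsto_of_tendsto' ((hF.tendsto x).comp hx) ?_ fun n => (hu n).le
  simpa using tendsto_const_nhds.add (tendsto_one_div_add_atTop_nhds_zero_nat (𝕜 := ℝ))

section AsplundFunction

variable {H : Type*} [NormedAddCommGroup H]

/-- The Asplund function `x ↦ (‖x‖² - d(x, K)²) / 2` of a set `K`. -/
noncomputable def asplund (K : Set H) (x : H) : ℝ := (‖x‖ ^ 2 - infDist x K ^ 2) / 2

theorem continuous_asplund (K : Set H) : Continuous (asplund K) := by
  unfold asplund
  have := continuous_infDist_pt K
  fun_prop

variable [InnerProductSpace ℝ H]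

theorem inner_sub_le_asplund {K : Set H} (x : H) {y : H} (hy : y ∈ K) :
    inner ℝ x y - ‖y‖ ^ 2 / 2 ≤ asplund K x := by
  have h : infDist x K ≤ ‖x - y‖ := dist_eq_norm x y ▸ infDist_le_dist_of_mem hy
  have hsq : infDist x K ^ 2 ≤ ‖x - y‖ ^ 2 := pow_le_pow_left₀ infDist_nonneg h 2
  rw [norm_sub_sq_real] at hsq
  unfold asplund
  linarith

theorem asplund_eq_of_norm_sub_eq_infDist {K : Set H} {x y : H} (h : ‖x - y‖ = infDist x K) :
    asplund K x = inner ℝ x y - ‖y‖ ^ 2 / 2 := by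
  rw [asplund, ← h, norm_sub_sq_real]
  ring

theorem asplund_midpoint_le {K : Set H} {p : H → H}
    (hp : ∀ x, p x ∈ K ∧ ‖x - p x‖ = infDist x K) (a b : H) :
    asplund K ((1 / 2 : ℝ) • (a + b)) ≤ (asplund K a + asplund K b) / 2 := by
  obtain ⟨hK, hd⟩ := hp ((1 / 2 : ℝ) • (a + b))
  have ha := inner_sub_le_asplund a hK
  have hb := inner_sub_le_asplund b hK
  rw [asplund_eq_of_norm_sub_eq_infDist hd, real_inner_smul_left, inner_add_left]
  linarith

theorem asplund_add_le {K : Set H} {p : H → H}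
    (hp : ∀ x, p x ∈ K ∧ ‖x - p x‖ = infDist x K) (x h : H) :
    asplund K (x + h) ≤ asplund K x + inner ℝ h (p (x + h)) := by
  have hx := inner_sub_le_asplund x (hp (x + h)).1
  rw [asplund_eq_of_norm_sub_eq_infDist (hp (x + h)).2, inner_add_left]
  linarith

end AsplundFunction

/-- Along a subsequence, nearest points in an approximately compact set converge to a nearest
point of the limit. -/
theorem exists_subseq_tendsto_nearest
    {H : Type*} [NormedAddCommGroup H] {K : Set H} {p : H → H}
    (hp : ∀ x, p x ∈ K ∧ ‖x - p x‖ = infDist x K)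
    (happrox : ∀ (x : H) (y : ℕ → H), (∀ n, y n ∈ K) →
      Tendsto (fun n => ‖x - y n‖) atTop (nhds (infDist x K)) →
      ∃ φ : ℕ → ℕ, StrictMono φ ∧ ∃ z ∈ K, Tendsto (y ∘ φ) atTop (nhds z))
    {x : H} {u : ℕ → H} (hu : Tendsto u atTop (nhds x)) :
    ∃ φ : ℕ → ℕ, StrictMono φ ∧ ∃ z ∈ K, ‖x - z‖ = infDist x K ∧
      Tendsto (fun n => p (u (φ n))) atTop (nhds z) := by
  have hlim : Tendsto (fun n => ‖x - p (u n)‖) atTop (nhds (infDist x K)) := by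
    have hupper : Tendsto (fun n => ‖x - u n‖ + infDist (u n) K) atTop
        (nhds (infDist x K)) := by
      have h := (hu.const_sub x).norm.add (((continuous_infDist_pt K).tendsto x).comp hu)
      simpa using h
    refine tendsto_of_tendsto_of_tendsto_of_le_of_le tendsto_const_nhds hupper
      (fun n => ?_) (fun n => ?_)
    · exact dist_eq_norm x (p (u n)) ▸ infDist_le_dist_of_mem (hp (u n)).1
    · simpa only [← (hp (u n)).2] using norm_sub_le_norm_sub_add_norm_sub x (u n) (p (u n))
  obtain ⟨φ, hφ, z, hz, hzlim⟩ := happrox x (fun n => p (u n)) (fun n => (hp _).1) hlim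
  exact ⟨φ, hφ, z, hz,
    tendsto_nhds_unique (hzlim.const_sub x).norm (hlim.comp hφ.tendsto_atTop), hzlim⟩

/-- (Efimov–Stechkin, 1961) An approximately compact Chebyshev subset of a real
Hilbert space is convex. -/
theorem chebyshev_approx_compact_convex
    {H : Type*} [NormedAddCommGroup H] [InnerProductSpace ℝ H] [CompleteSpace H]
    (K : Set H)
    (hcheb : ∀ x : H, ∃! y, y ∈ K ∧ ‖x - y‖ = infDist x K)
    (happrox : ∀ (x : H) (y : ℕ → H), (∀ n, y n ∈ K) →
      Tendsto (fun n => ‖x - y n‖) atTop (nhds (infDist x K)) →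
      ∃ φ : ℕ → ℕ, StrictMono φ ∧ ∃ z ∈ K, Tendsto (y ∘ φ) atTop (nhds z)) :
    Convex ℝ K := by
  choose p hp huniq using hcheb
  intro y₁ hy₁ y₂ hy₂ a b ha hb hab
  set z := a • y₁ + b • y₂ with hz
  set C := a * (‖y₁‖ ^ 2 / 2) + b * (‖y₂‖ ^ 2 / 2) with hC
  have hlower : ∀ x, -C ≤ asplund K x - inner ℝ x z := by
    intro x
    have h₁ := mul_le_mul_of_nonneg_left (inner_sub_le_asplund x hy₁) ha
    have h₂ := mul_le_mul_of_nonneg_left (inner_sub_le_asplund x hy₂) hb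
    have h₃ : a * asplund K x + b * asplund K x = asplund K x := by rw [← add_mul, hab, one_mul]
    rw [hz, inner_add_right, real_inner_smul_right, real_inner_smul_right]
    linarith
  -- Minimize the Asplund function tilted by `z` with a small quadratic penalty.
  have hreg : ∀ ε : ℝ, 0 < ε → infDist z K ^ 2 ≤ ε * (2 * (asplund K 0 + C)) := by
    intro ε hε
    obtain ⟨x, hx⟩ := exists_forall_le_of_strongly_midpoint_convex
      (F := fun x => asplund K x - inner ℝ x z + ε / 2 * ‖x‖ ^ 2) (c := ε / 8)
      (by have := continuous_asplund K; fun_prop)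
      ⟨-C, by
        rintro _ ⟨x, rfl⟩
        have : 0 ≤ ε / 2 * ‖x‖ ^ 2 := by positivity
        linarith [hlower x]⟩
      (by positivity)
      (fun a b => by
        have h := asplund_midpoint_le hp a b
        have hn : ‖(1 / 2 : ℝ) • (a + b)‖ ^ 2 = (‖a‖ ^ 2 + ‖b‖ ^ 2) / 2 - ‖a - b‖ ^ 2 / 4 := by
          rw [norm_smul, mul_pow, norm_add_sq_real, norm_sub_sq_real]
          norm_num
          ring
        simp only [hn, real_inner_smul_left, inner_add_left]
        linarith)
    set v := p x - z + ε • x with hv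
    let t : ℕ → ℝ := fun n => 1 / ((n : ℝ) + 1)
    have ht : Tendsto t atTop (nhds 0) := tendsto_one_div_add_atTop_nhds_zero_nat
    have htpos : ∀ n, 0 < t n := fun n => Nat.one_div_pos_of_nat
    have hu : Tendsto (fun n => x + -(t n • v)) atTop (nhds x) := by
      simpa using ((ht.smul_const v).neg).const_add x
    obtain ⟨φ, hφ, w, hw, hwd, hwlim⟩ := exists_subseq_tendsto_nearest hp happrox hu
    obtain rfl : w = p x := huniq x w ⟨hw, hwd⟩
    have hstep : ∀ n, inner ℝ v (p (x + -(t n • v)) - z + ε • x) ≤ ε / 2 * (t n * ‖v‖ ^ 2) := by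
      intro n
      have h₁ := hx (x + -(t n • v))
      have h₂ := asplund_add_le hp x (-(t n • v))
      have h₃ : ‖x + -(t n • v)‖ ^ 2 = ‖x‖ ^ 2 - 2 * (t n * inner ℝ v x) + t n ^ 2 * ‖v‖ ^ 2 := by
        rw [← sub_eq_add_neg, norm_sub_sq_real, real_inner_smul_right, norm_smul, mul_pow,
          Real.norm_eq_abs, sq_abs, real_inner_comm]
      simp only [h₃, inner_add_left, inner_neg_left, real_inner_smul_left] at h₁ h₂
      refine le_of_mul_le_mul_left ?_ (htpos n)
      rw [inner_add_right, inner_sub_right, real_inner_smul_right]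
      linarith
    have hv0 : v = 0 := by
      have htφ := ht.comp hφ.tendsto_atTop
      have h : inner ℝ v v ≤ ε / 2 * (0 * ‖v‖ ^ 2) :=
        le_of_tendsto_of_tendsto'
          (tendsto_const_nhds.inner ((hwlim.sub_const z).add_const (ε • x)))
          ((htφ.mul_const (‖v‖ ^ 2)).const_mul (ε / 2)) fun n => hstep (φ n)
      rw [zero_mul, mul_zero, real_inner_self_eq_norm_sq] at h
      simpa using le_antisymm h (sq_nonneg _)
    have hzp : z - p x = ε • x := by
      rw [hv] at hv0
      rw [← sub_eq_zero, ← neg_eq_zero, ← hv0]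
      abel_nf
    have hdist : infDist z K ≤ ε * ‖x‖ := by
      calc infDist z K ≤ dist z (p x) := infDist_le_dist_of_mem hw
        _ = ε * ‖x‖ := by rw [dist_eq_norm, hzp, norm_smul, Real.norm_of_nonneg hε.le]
    have hx0 : ε * ‖x‖ ^ 2 ≤ 2 * (asplund K 0 + C) := by
      have h := hx 0
      simp only [inner_zero_left, norm_zero] at h
      linarith [hlower x]
    calc infDist z K ^ 2 ≤ (ε * ‖x‖) ^ 2 := pow_le_pow_left₀ infDist_nonneg hdist 2
      _ = ε * (ε * ‖x‖ ^ 2) := by ring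
      _ ≤ _ := mul_le_mul_of_nonneg_left hx0 hε.le
  have hsq : infDist z K ^ 2 ≤ 0 := by
    have hlim : Tendsto (fun n : ℕ => 1 / ((n : ℝ) + 1) * (2 * (asplund K 0 + C))) atTop
        (nhds (0 * (2 * (asplund K 0 + C)))) :=
      tendsto_one_div_add_atTop_nhds_zero_nat.mul_const _
    rw [zero_mul] at hlim
    exact ge_of_tendsto' hlim fun n => hreg _ Nat.one_div_pos_of_nat
  have hzero : infDist z K = 0 := by
    simpa using le_antisymm hsq (sq_nonneg _)
  have hpz : z = p z := by
    rw [← sub_eq_zero, ← norm_eq_zero, (hp z).2, hzero]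
  exact hpz ▸ (hp z).1
end

section
/- (Asplund) Let H be a real Hilbert space and let K be a nonempty subset of H. Then the function x ↦ (‖x‖² − d(x, K)²)/2 is convex on H. -/
open Metric

/-- (Asplund) For a nonempty subset `K` of a real Hilbert space, the function
`x ↦ (‖x‖² − d(x, K)²) / 2` is convex. -/
theorem asplund_function_convex
    {H : Type*} [NormedAddCommGroup H] [InnerProductSpace ℝ H] [CompleteSpace H]
    (K : Set H) (hne : K.Nonempty) :
    ConvexOn ℝ Set.univ (fun x : H => (‖x‖ ^ 2 - infDist x K ^ 2) / 2) := by
  refine ⟨convex_univ, fun x _ y _ a b ha hb hab => ?_⟩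
  have expand (k : H) : a * ‖x - k‖ ^ 2 + b * ‖y - k‖ ^ 2 =
      ‖a • x + b • y - k‖ ^ 2 + (a * ‖x‖ ^ 2 + b * ‖y‖ ^ 2 - ‖a • x + b • y‖ ^ 2) := by
    rw [norm_sub_sq_real, norm_sub_sq_real, norm_sub_sq_real, inner_add_left,
      real_inner_smul_left, real_inner_smul_left]
    linear_combination ‖k‖ ^ 2 * hab
  have key : √(a * infDist x K ^ 2 + b * infDist y K ^ 2 -
      (a * ‖x‖ ^ 2 + b * ‖y‖ ^ 2 - ‖a • x + b • y‖ ^ 2)) ≤ infDist (a • x + b • y) K := by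
    refine (le_infDist hne).2 fun k hk => Real.sqrt_le_iff.2 ⟨dist_nonneg, ?_⟩
    have hx : a * infDist x K ^ 2 ≤ a * ‖x - k‖ ^ 2 := by
      rw [← dist_eq_norm]
      gcongr
      · exact infDist_nonneg
      · exact infDist_le_dist_of_mem hk
    have hy : b * infDist y K ^ 2 ≤ b * ‖y - k‖ ^ 2 := by
      rw [← dist_eq_norm]
      gcongr
      · exact infDist_nonneg
      · exact infDist_le_dist_of_mem hk
    rw [dist_eq_norm]
    linarith [expand k]
  have := (Real.sqrt_le_iff.1 key).2
  simp only [smul_eq_mul]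
  linarith
end
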